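/- arXiv:2602.13848 — 2 statements merged into one kernel-verified Lean document; each statement's English description precedes it below -/
import Mathlib

section
/- Let p̂ be a [0,1]-valued random variable and ε : [0,1] → [0,1] a measurable function with ε* := sup_{p ∈ [0,1]} ε(p). Set μ := E[p̂] − 1/2 and ε̄ := E[ε(p̂)], and assume μ ≠ 0 and Δ₀ := |μ| − ε̄ > 0. Define the limiting (k = 0) betting gain g₀(p, η) := 𝒞₀·(η·(p − 1/2) − |η|·ε(p)) with scaling constant 𝒞₀ := 1/(1/2 + ε*). Then sup_{η ∈ [−1/2, 1/2]} E[ln(1 + g₀(p̂, η))] ≥ Δ₀²/(4·(1 + Δ₀²)). -/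
open MeasureTheory

noncomputable section

/-- `ε* := sup_{p ∈ [0,1]} ε(p)`. -/
def epsStar (eps : ℝ → ℝ) : ℝ := sSup (eps '' Set.Icc (0 : ℝ) 1)

/-- The limiting (`k = 0`) betting gain `g₀(p, η) := 𝒞₀·(η·(p − 1/2) − |η|·ε(p))` with
scaling constant `𝒞₀ := 1/(1/2 + ε*)`. -/
def g0 (eps : ℝ → ℝ) (p η : ℝ) : ℝ :=
  (1 / (1 / 2 + epsStar eps)) * (η * (p - 1 / 2) - |η| * eps p)

theorem sub_sq_le_log_one_add {c : ℝ} (hc : |c| ≤ 1 / 3) : c - c ^ 2 ≤ Real.log (1 + c) := by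
  have h := Real.abs_log_sub_add_sum_range_le (x := -c) (by rw [abs_neg]; linarith) 2
  simp only [Finset.sum_range_succ, Finset.sum_range_zero, abs_neg, sub_neg_eq_add] at h
  norm_num at h
  have h2 : |c| ^ 3 / (1 - |c|) ≤ c ^ 2 / 2 := by
    rw [div_le_iff₀ (by linarith), ← sq_abs c]
    nlinarith [mul_nonneg (sq_nonneg |c|) (sub_nonneg.2 hc)]
  have := (abs_le.1 (h.trans h2)).1
  linarith

theorem abs_log_one_add_le_one {c : ℝ} (hc : |c| ≤ 1 / 2) : |Real.log (1 + c)| ≤ 1 := by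
  obtain ⟨h1, h2⟩ := abs_le.1 hc
  have hpos : 0 < 1 + c := by linarith
  have hinv : (1 + c)⁻¹ ≤ 2 := inv_le_of_inv_le₀ two_pos (by linarith)
  have := Real.one_sub_inv_le_log_of_pos hpos
  have := Real.log_le_sub_one_of_pos hpos
  exact abs_le.2 ⟨by linarith, by linarith⟩

theorem le_epsStar {eps : ℝ → ℝ} (heps01 : ∀ q ∈ Set.Icc (0 : ℝ) 1, eps q ∈ Set.Icc (0 : ℝ) 1)
    {q : ℝ} (hq : q ∈ Set.Icc (0 : ℝ) 1) : eps q ≤ epsStar eps :=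
  le_csSup ⟨1, by rintro _ ⟨x, hx, rfl⟩; exact (heps01 x hx).2⟩ (Set.mem_image_of_mem _ hq)

theorem epsStar_mem_Icc {eps : ℝ → ℝ}
    (heps01 : ∀ q ∈ Set.Icc (0 : ℝ) 1, eps q ∈ Set.Icc (0 : ℝ) 1) :
    epsStar eps ∈ Set.Icc (0 : ℝ) 1 := by
  have h0 : (0 : ℝ) ∈ Set.Icc (0 : ℝ) 1 := by simp
  refine ⟨(heps01 0 h0).1.trans (le_epsStar heps01 h0), csSup_le ⟨_, 0, h0, rfl⟩ ?_⟩
  rintro _ ⟨x, hx, rfl⟩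
  exact (heps01 x hx).2

theorem abs_g0_le_half {eps : ℝ → ℝ}
    (heps01 : ∀ q ∈ Set.Icc (0 : ℝ) 1, eps q ∈ Set.Icc (0 : ℝ) 1) {p η : ℝ}
    (hp : p ∈ Set.Icc (0 : ℝ) 1) (hη : η ∈ Set.Icc (-(1 / 2) : ℝ) (1 / 2)) :
    |g0 eps p η| ≤ 1 / 2 := by
  have hS := (epsStar_mem_Icc heps01).1
  have he := le_epsStar heps01 hp
  have he0 := (heps01 p hp).1
  have hη' : |η| ≤ 1 / 2 := abs_le.2 hη
  have hp' : |p - 1 / 2| ≤ 1 / 2 := abs_le.2 ⟨by linarith [hp.1], by linarith [hp.2]⟩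
  have hpos : 0 < 1 / 2 + epsStar eps := by linarith
  have key : |η * (p - 1 / 2) - |η| * eps p| ≤ 1 / 2 * (1 / 2 + epsStar eps) := by
    calc |η * (p - 1 / 2) - |η| * eps p| ≤ |η * (p - 1 / 2)| + |(|η| * eps p)| := abs_sub _ _
      _ = |η| * (|p - 1 / 2| + eps p) := by
        rw [abs_mul, abs_mul, abs_abs, abs_of_nonneg he0]; ring
      _ ≤ 1 / 2 * (1 / 2 + epsStar eps) := by gcongr
  rw [g0, abs_mul, abs_of_pos (one_div_pos.2 hpos), one_div_mul_eq_div, div_le_iff₀ hpos]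
  exact key

/-- Let `p̂` be a `[0,1]`-valued random variable, `ε : [0,1] → [0,1]`
measurable, `μ := E[p̂] − 1/2`, `ε̄ := E[ε(p̂)]`, with `μ ≠ 0` and
`Δ₀ := |μ| − ε̄ > 0`. Then
`sup_{η ∈ [−1/2, 1/2]} E[ln(1 + g₀(p̂, η))] ≥ Δ₀²/(4·(1 + Δ₀²))`. -/
theorem stmt10 {Ω : Type*} [MeasurableSpace Ω] (μ : Measure Ω) [IsProbabilityMeasure μ]
    (phat : Ω → ℝ) (hpm : Measurable phat) (hp01 : ∀ ω, phat ω ∈ Set.Icc (0 : ℝ) 1)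
    (eps : ℝ → ℝ) (hepsMeas : Measurable eps)
    (heps01 : ∀ q ∈ Set.Icc (0 : ℝ) 1, eps q ∈ Set.Icc (0 : ℝ) 1)
    (hμne : (∫ ω, phat ω ∂μ) - 1 / 2 ≠ 0)
    (hΔ : 0 < |(∫ ω, phat ω ∂μ) - 1 / 2| - ∫ ω, eps (phat ω) ∂μ) :
    (|(∫ ω, phat ω ∂μ) - 1 / 2| - ∫ ω, eps (phat ω) ∂μ) ^ 2
        / (4 * (1 + (|(∫ ω, phat ω ∂μ) - 1 / 2| - ∫ ω, eps (phat ω) ∂μ) ^ 2))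
      ≤ sSup ((fun η => ∫ ω, Real.log (1 + g0 eps (phat ω) η) ∂μ) ''
          Set.Icc (-(1 / 2) : ℝ) (1 / 2)) := by
  set m := (∫ ω, phat ω ∂μ) - 1 / 2 with hm
  set e := ∫ ω, eps (phat ω) ∂μ with he
  set D := |m| - e with hD
  have hem : Measurable fun ω => eps (phat ω) := hepsMeas.comp hpm
  have hpint : Integrable phat μ := Integrable.of_bound hpm.aestronglyMeasurable 1
    (ae_of_all _ fun ω => abs_le.2 ⟨by linarith [(hp01 ω).1], (hp01 ω).2⟩)
  have heint : Integrable (fun ω => eps (phat ω)) μ := Integrable.of_bound hem.aestronglyMeasurable 1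
    (ae_of_all _ fun ω => abs_le.2
      ⟨by linarith [(heps01 _ (hp01 ω)).1], (heps01 _ (hp01 ω)).2⟩)
  have hD2 : D ≤ 1 / 2 := by
    have he0 : 0 ≤ e := integral_nonneg fun ω => (heps01 _ (hp01 ω)).1
    have hp0 : 0 ≤ ∫ ω, phat ω ∂μ := integral_nonneg fun ω => (hp01 ω).1
    have hp1 : ∫ ω, phat ω ∂μ ≤ 1 := by
      simpa using integral_mono hpint (integrable_const (1 : ℝ)) fun ω => (hp01 ω).2
    have : |m| ≤ 1 / 2 := abs_le.2 ⟨by linarith, by linarith⟩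
    linarith
  have hS := epsStar_mem_Icc heps01
  have hSpos : 0 < 1 / 2 + epsStar eps := by linarith [hS.1]
  obtain ⟨s, hs1, hsm⟩ : ∃ s : ℝ, |s| = 1 ∧ |m| = s * m := by
    rcases abs_cases m with h | h
    · exact ⟨1, by simp, by linarith⟩
    · exact ⟨-1, by simp, by linarith⟩
  set t := D / (2 * (1 + D ^ 2)) with ht
  have ht0 : 0 < t := by positivity
  have ht1 : t ≤ 1 / 5 := by
    rw [ht, div_le_iff₀ (by positivity)]
    nlinarith
  have hη : s * (t * (1 / 2 + epsStar eps)) ∈ Set.Icc (-(1 / 2) : ℝ) (1 / 2) := by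
    refine abs_le.1 ?_
    rw [abs_mul, hs1, one_mul, abs_of_pos (by positivity)]
    nlinarith [hS.1, hS.2]
  have hbdd : BddAbove ((fun η => ∫ ω, Real.log (1 + g0 eps (phat ω) η) ∂μ) ''
      Set.Icc (-(1 / 2) : ℝ) (1 / 2)) := by
    refine ⟨1, ?_⟩
    rintro _ ⟨η, hη, rfl⟩
    have := norm_integral_le_of_norm_le_const (μ := μ) (C := 1)
      (f := fun ω => Real.log (1 + g0 eps (phat ω) η))
      (ae_of_all _ fun ω => abs_log_one_add_le_one (abs_g0_le_half heps01 (hp01 ω) hη))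
    simp only [probReal_univ, mul_one] at this
    exact (le_abs_self _).trans this
  refine le_trans ?_ (le_csSup hbdd (Set.mem_image_of_mem _ hη))
  have hg : ∀ ω, g0 eps (phat ω) (s * (t * (1 / 2 + epsStar eps)))
      = t * (s * (phat ω - 1 / 2) - eps (phat ω)) := by
    intro ω
    rw [g0, abs_mul, hs1, abs_of_pos (show 0 < t * (1 / 2 + epsStar eps) by positivity),
      one_div_mul_eq_div, div_eq_iff hSpos.ne']
    ring
  have hlogint : Integrable (fun ω => Real.log (1 + g0 eps (phat ω)
      (s * (t * (1 / 2 + epsStar eps))))) μ := by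
    refine Integrable.of_bound ?_ 1
      (ae_of_all _ fun ω => abs_log_one_add_le_one (abs_g0_le_half heps01 (hp01 ω) hη))
    simp only [hg]
    exact Measurable.aestronglyMeasurable (by fun_prop)
  have hsint : Integrable (fun ω => s * (phat ω - 1 / 2)) μ :=
    (hpint.sub (integrable_const _)).const_mul s
  have hZint : Integrable (fun ω => s * (phat ω - 1 / 2) - eps (phat ω)) μ :=
    hsint.sub heint
  have hZ : ∫ ω, (s * (phat ω - 1 / 2) - eps (phat ω)) ∂μ = D := by
    rw [integral_sub hsint heint, integral_const_mul,
      integral_sub hpint (integrable_const _)]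
    rw [hD, hsm, hm, he]
    simp
  have hlower : (t + t ^ 2) * D - t ^ 2 * (3 / 4)
      ≤ ∫ ω, Real.log (1 + g0 eps (phat ω) (s * (t * (1 / 2 + epsStar eps)))) ∂μ := by
    have hval : ∫ ω, ((t + t ^ 2) * (s * (phat ω - 1 / 2) - eps (phat ω)) - t ^ 2 * (3 / 4)) ∂μ
        = (t + t ^ 2) * D - t ^ 2 * (3 / 4) := by
      rw [integral_sub (hZint.const_mul _) (integrable_const _), integral_const_mul, hZ]
      simp
    rw [← hval]
    refine integral_mono ((hZint.const_mul _).sub (integrable_const _)) hlogint fun ω => ?_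
    simp only [hg]
    set Z := s * (phat ω - 1 / 2) - eps (phat ω) with hZdef
    have hsp : |s * (phat ω - 1 / 2)| ≤ 1 / 2 := by
      rw [abs_mul, hs1, one_mul]
      exact abs_le.2 ⟨by linarith [(hp01 ω).1], by linarith [(hp01 ω).2]⟩
    have hZ1 : Z ≤ 1 / 2 := by linarith [(abs_le.1 hsp).2, (heps01 _ (hp01 ω)).1]
    have hZ2 : -(3 / 2) ≤ Z := by linarith [(abs_le.1 hsp).1, (heps01 _ (hp01 ω)).2]
    have hquad : Z ^ 2 ≤ 3 / 4 - Z := by nlinarith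
    have hc : |t * Z| ≤ 1 / 3 := abs_le.2 ⟨by nlinarith, by nlinarith⟩
    have hlog := sub_sq_le_log_one_add hc
    nlinarith [mul_le_mul_of_nonneg_left hquad (sq_nonneg t)]
  refine le_trans ?_ hlower
  have hE : D ^ 2 / (4 * (1 + D ^ 2)) = t * D - t ^ 2 * (1 + D ^ 2) := by
    rw [ht]
    field_simp
    ring
  rw [hE]
  nlinarith [mul_nonneg (sq_nonneg t) hΔ.le, mul_nonneg (sq_nonneg t) (sq_nonneg D), sq_nonneg t]

end
end

section
/- Let p̂ be a [0,1]-valued random variable and ε : [0,1] → [0,1] a measurable function with ε* := sup_{p ∈ [0,1]} ε(p). Set μ := E[p̂] − 1/2 and ε̄ := E[ε(p̂)], and assume μ > ε̄ ≥ 0. Fix any λ > ε̄/√(μ² − ε̄²) and set ρ := μ·λ − ε̄·√(1 + λ²). Then ρ > 0, and there exists k₀ > 0 such that for every k ∈ (0, k₀), taking η := λ·k one has η ∈ (0, 1/2) and E[ln(1 + g_k(p̂, η))] ≥ 𝒞·ρ·k/4 > 0, where 𝒞 := 1/(1/2 + √(1+k²)·ε*). -/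
open MeasureTheory

noncomputable section

/-- The scaling constant `𝒞 := 1/(1/2 + √(1+k²)·ε*)`. -/
def Ck (eps : ℝ → ℝ) (k : ℝ) : ℝ :=
  1 / (1 / 2 + Real.sqrt (1 + k ^ 2) * epsStar eps)

/-- The betting gain `g_k(p, η) := 𝒞·(η·(p − 1/2) − √(η² + k²)·ε(p))`. -/
def gk (eps : ℝ → ℝ) (k p η : ℝ) : ℝ :=
  Ck eps k * (η * (p - 1 / 2) - Real.sqrt (η ^ 2 + k ^ 2) * eps p)

lemma epsStar_nonneg {eps : ℝ → ℝ} (h : ∀ q ∈ Set.Icc (0 : ℝ) 1, 0 ≤ eps q) :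
    0 ≤ epsStar eps :=
  Real.sSup_nonneg fun _ ⟨q, hq, hqx⟩ => hqx ▸ h q hq

lemma Ck_pos {eps : ℝ → ℝ} (h : 0 ≤ epsStar eps) (k : ℝ) : 0 < Ck eps k := by
  unfold Ck
  positivity

lemma Ck_le_two {eps : ℝ → ℝ} (h : 0 ≤ epsStar eps) (k : ℝ) : Ck eps k ≤ 2 := by
  have : 0 ≤ Real.sqrt (1 + k ^ 2) * epsStar eps := by positivity
  unfold Ck
  rw [div_le_iff₀ (by linarith)]
  linarith

/-- At `η = λ·k` with `k ≥ 0` the betting gain is linear in `k` up to the factor `Ck eps k`. -/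
lemma gk_mul_left (eps : ℝ → ℝ) {k : ℝ} (hk : 0 ≤ k) (p lam : ℝ) :
    gk eps k p (lam * k) =
      Ck eps k * k * (lam * (p - 1 / 2) - Real.sqrt (1 + lam ^ 2) * eps p) := by
  have : Real.sqrt ((lam * k) ^ 2 + k ^ 2) = Real.sqrt (1 + lam ^ 2) * k := by
    rw [show (lam * k) ^ 2 + k ^ 2 = (1 + lam ^ 2) * k ^ 2 by ring,
      Real.sqrt_mul (by positivity), Real.sqrt_sq hk]
  rw [gk, this]
  ring

lemma sub_two_mul_sq_le_log_one_add {x : ℝ} (hx : -(1 / 2) ≤ x) :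
    x - 2 * x ^ 2 ≤ Real.log (1 + x) := by
  have hpos : 0 < 1 + x := by linarith
  refine le_trans ?_ (Real.one_sub_inv_le_log_of_pos hpos)
  rw [← sub_nonneg]
  have : 1 - (1 + x)⁻¹ - (x - 2 * x ^ 2) = x ^ 2 * (1 + 2 * x) / (1 + x) := by
    field_simp
    ring
  rw [this]
  have : 0 ≤ 1 + 2 * x := by linarith
  positivity

/-- A bounded random variable with absolute value at most `b ≤ 1 / 2` satisfies
`E[ln (1 + X)] ≥ E[X] - 2 b²`. -/
lemma integral_sub_le_integral_log_one_add {Ω : Type*} [MeasurableSpace Ω] (μ : Measure Ω)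
    [IsProbabilityMeasure μ] {X : Ω → ℝ} (hX : Measurable X) {b : ℝ} (hb : b ≤ 1 / 2)
    (hXb : ∀ ω, |X ω| ≤ b) :
    (∫ ω, X ω ∂μ) - 2 * b ^ 2 ≤ ∫ ω, Real.log (1 + X ω) ∂μ := by
  have hXint : Integrable X μ :=
    Integrable.of_bound hX.aestronglyMeasurable b (.of_forall hXb)
  have hlow : ∀ ω, X ω - 2 * b ^ 2 ≤ Real.log (1 + X ω) := fun ω => by
    have h1 := sub_two_mul_sq_le_log_one_add (x := X ω) (by linarith [(abs_le.1 (hXb ω)).1])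
    have h2 : X ω ^ 2 ≤ b ^ 2 := sq_le_sq' (abs_le.1 (hXb ω)).1 (abs_le.1 (hXb ω)).2
    linarith
  have hup : ∀ ω, Real.log (1 + X ω) ≤ X ω := fun ω => by
    have := Real.log_le_sub_one_of_pos (x := 1 + X ω) (by linarith [(abs_le.1 (hXb ω)).1])
    linarith
  have hlint : Integrable (fun ω => X ω - 2 * b ^ 2) μ := hXint.sub (integrable_const _)
  have hlog : Integrable (fun ω => Real.log (1 + X ω)) μ :=
    integrable_of_le_of_le (hX.const_add 1).log.aestronglyMeasurable (.of_forall hlow) (.of_forall hup) hlint hXint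
  calc (∫ ω, X ω ∂μ) - 2 * b ^ 2 = ∫ ω, (X ω - 2 * b ^ 2) ∂μ := by
        rw [integral_sub hXint (integrable_const _)]
        simp
    _ ≤ _ := integral_mono hlint hlog hlow

lemma mul_sub_mul_sqrt_pos {m e lam : ℝ} (he : 0 ≤ e) (hm : e < m)
    (hlam : e / Real.sqrt (m ^ 2 - e ^ 2) < lam) :
    0 < m * lam - e * Real.sqrt (1 + lam ^ 2) := by
  have hd : 0 < m ^ 2 - e ^ 2 := by nlinarith
  have hlam0 : 0 < lam := lt_of_le_of_lt (by positivity) hlam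
  have hsq : e ^ 2 < lam ^ 2 * (m ^ 2 - e ^ 2) := by
    rw [div_lt_iff₀ (Real.sqrt_pos.2 hd)] at hlam
    have := pow_lt_pow_left₀ hlam he two_ne_zero
    rwa [mul_pow, Real.sq_sqrt hd.le] at this
  have hm0 : 0 < m := he.trans_lt hm
  refine sub_pos.2 (lt_of_pow_lt_pow_left₀ 2 (by positivity) ?_)
  rw [mul_pow, Real.sq_sqrt (by positivity)]
  linarith

/-- Let `p̂` be a `[0,1]`-valued random variable, `ε : [0,1] → [0,1]`
measurable with `ε* := sup_{p ∈ [0,1]} ε(p)`, `μ := E[p̂] − 1/2`, `ε̄ := E[ε(p̂)]`, and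
assume `μ > ε̄ ≥ 0`. Fix `λ > ε̄/√(μ² − ε̄²)` and set `ρ := μ·λ − ε̄·√(1 + λ²)`. Then
`ρ > 0`, and there is `k₀ > 0` such that for every `k ∈ (0, k₀)`, with `η := λ·k` one has
`η ∈ (0, 1/2)` and `E[ln(1 + g_k(p̂, η))] ≥ 𝒞·ρ·k/4 > 0`, where
`𝒞 := 1/(1/2 + √(1+k²)·ε*)`. -/
theorem stmt14 {Ω : Type*} [MeasurableSpace Ω] (μ : Measure Ω) [IsProbabilityMeasure μ]
    (phat : Ω → ℝ) (hpm : Measurable phat) (hp01 : ∀ ω, phat ω ∈ Set.Icc (0 : ℝ) 1)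
    (eps : ℝ → ℝ) (hepsMeas : Measurable eps)
    (heps01 : ∀ q ∈ Set.Icc (0 : ℝ) 1, eps q ∈ Set.Icc (0 : ℝ) 1)
    (hεnonneg : 0 ≤ ∫ ω, eps (phat ω) ∂μ)
    (hμε : ∫ ω, eps (phat ω) ∂μ < (∫ ω, phat ω ∂μ) - 1 / 2)
    (lam : ℝ)
    (hlam : (∫ ω, eps (phat ω) ∂μ) /
        Real.sqrt (((∫ ω, phat ω ∂μ) - 1 / 2) ^ 2 - (∫ ω, eps (phat ω) ∂μ) ^ 2) < lam) :
    0 < ((∫ ω, phat ω ∂μ) - 1 / 2) * lam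
        - (∫ ω, eps (phat ω) ∂μ) * Real.sqrt (1 + lam ^ 2)
    ∧ ∃ k₀ > (0 : ℝ), ∀ k ∈ Set.Ioo (0 : ℝ) k₀,
        lam * k ∈ Set.Ioo (0 : ℝ) (1 / 2)
        ∧ 0 < Ck eps k * (((∫ ω, phat ω ∂μ) - 1 / 2) * lam
            - (∫ ω, eps (phat ω) ∂μ) * Real.sqrt (1 + lam ^ 2)) * k / 4
        ∧ Ck eps k * (((∫ ω, phat ω ∂μ) - 1 / 2) * lam
            - (∫ ω, eps (phat ω) ∂μ) * Real.sqrt (1 + lam ^ 2)) * k / 4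
          ≤ ∫ ω, Real.log (1 + gk eps k (phat ω) (lam * k)) ∂μ := by
  set m := (∫ ω, phat ω ∂μ) - 1 / 2
  set e := ∫ ω, eps (phat ω) ∂μ
  have hρ := mul_sub_mul_sqrt_pos hεnonneg hμε hlam
  have hlam0 : 0 < lam := lt_of_le_of_lt (by positivity) hlam
  set s := Real.sqrt (1 + lam ^ 2)
  set ρ := m * lam - e * s with hρdef
  have hs0 : 0 < s := Real.sqrt_pos.2 (by positivity)
  have hlams : lam ≤ s := Real.le_sqrt_of_sq_le (by linarith)
  set M := lam / 2 + s with hM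
  have hM0 : 0 < M := by positivity
  have hstar := epsStar_nonneg fun q hq => (heps01 q hq).1
  refine ⟨hρ, min (1 / (4 * M)) (ρ / (8 * M ^ 2)), by positivity, fun k ⟨hk0, hk⟩ => ?_⟩
  obtain ⟨hk1, hk2⟩ := lt_min_iff.1 hk
  rw [lt_div_iff₀ (by positivity)] at hk1 hk2
  have hC0 := Ck_pos hstar k
  have hC2 := Ck_le_two hstar k
  set C := Ck eps k
  refine ⟨⟨by positivity, by nlinarith⟩, by positivity, ?_⟩
  have hbound : ∀ ω, |lam * (phat ω - 1 / 2) - s * eps (phat ω)| ≤ M := fun ω => by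
    obtain ⟨hp0, hp1⟩ := hp01 ω
    obtain ⟨he0, he1⟩ := heps01 _ (hp01 ω)
    rw [abs_le]
    constructor <;> nlinarith
  have hpint : Integrable phat μ :=
    Integrable.of_bound hpm.aestronglyMeasurable 1 (.of_forall fun ω => by
      rw [Real.norm_of_nonneg (hp01 ω).1]; exact (hp01 ω).2)
  have heint : Integrable (fun ω => eps (phat ω)) μ :=
    Integrable.of_bound (hepsMeas.comp hpm).aestronglyMeasurable 1 (.of_forall fun ω => by
      rw [Real.norm_of_nonneg (heps01 _ (hp01 ω)).1]; exact (heps01 _ (hp01 ω)).2)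
  have hlin : Integrable (fun ω => lam * (phat ω - 1 / 2)) μ :=
    (hpint.sub (integrable_const _)).const_mul _
  have hmean : ∫ ω, gk eps k (phat ω) (lam * k) ∂μ = C * k * ρ := by
    simp_rw [gk_mul_left eps hk0.le]
    rw [integral_const_mul, integral_sub hlin (heint.const_mul _), integral_const_mul,
      integral_const_mul, integral_sub hpint (integrable_const _)]
    simp only [integral_const, probReal_univ, one_smul]
    rw [hρdef]
    ring
  have hCk : C * k ≤ 2 * k := by gcongr
  have hkey := integral_sub_le_integral_log_one_add μ
    (X := fun ω => gk eps k (phat ω) (lam * k)) (b := C * k * M)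
    (by unfold gk; fun_prop) (by nlinarith) (fun ω => by
      rw [gk_mul_left eps hk0.le, abs_mul, abs_of_pos (by positivity)]
      gcongr
      exact hbound ω)
  rw [hmean] at hkey
  refine le_trans ?_ hkey
  have hquad : (C * k) * (C * k * M ^ 2) ≤ (C * k) * (ρ / 4) := by
    gcongr
    nlinarith [mul_le_mul_of_nonneg_right hCk (sq_nonneg M)]
  have : 0 < C * k * ρ := by positivity
  nlinarith
end
end
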